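/- If k ≥ 1, G is a maximal outerplanar graph of order n ≥ 2k+3, and n₂ is the number of vertices of G of degree 2, then the K_{1,k+1}-isolation number satisfies ι_k(G) ≤ (n − n₂)/(k+2). -/

import Mathlib

namespace MopPaper

/-- Cyclic successor on `Fin n`. -/
def finNext {n : ℕ} (i : Fin n) : Fin n := ⟨(i.val + 1) % n, Nat.mod_lt _ i.pos⟩

/-- A witness that `G` is a maximal outerplanar graph (mop): a cyclic ordering
`σ` of the vertices such that all Hamiltonian (boundary) edges are present,
no two edges cross with respect to the cyclic order (outerplanarity),
and `G` has exactly `2n - 3` edges (edge-maximality, i.e. a triangulation). -/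
def MopWitness {V : Type*} (G : SimpleGraph V) (n : ℕ) (σ : Fin n ≃ V) : Prop :=
  (∀ i : Fin n, G.Adj (σ i) (σ (finNext i))) ∧
  (∀ a b c d : Fin n, G.Adj (σ a) (σ b) → G.Adj (σ c) (σ d) →
      ¬ (a < c ∧ c < b ∧ b < d)) ∧
  Nat.card G.edgeSet = 2 * n - 3

/-- `G` is a maximal outerplanar graph (on at least 3 vertices). -/
def IsMop {V : Type*} (G : SimpleGraph V) : Prop :=
  ∃ n : ℕ, 3 ≤ n ∧ ∃ σ : Fin n ≃ V, MopWitness G n σ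

/-- `uv` is a Hamiltonian edge of the mop `G`: an edge lying on the (unique)
Hamiltonian cycle of `G`. -/
def IsHamEdge {V : Type*} (G : SimpleGraph V) (u v : V) : Prop :=
  ∃ n : ℕ, 3 ≤ n ∧ ∃ σ : Fin n ≃ V, MopWitness G n σ ∧
    ∃ i : Fin n, (σ i = u ∧ σ (finNext i) = v) ∨ (σ i = v ∧ σ (finNext i) = u)

/-- The closed neighborhood `N[S]` of a set of vertices. -/
def closedNbhd {V : Type*} (G : SimpleGraph V) (S : Set V) : Set V :=
  S ∪ {v | ∃ u ∈ S, G.Adj u v}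

/-- The set of vertices of degree 2. -/
def deg2set {V : Type*} (G : SimpleGraph V) : Set V :=
  {v | (G.neighborSet v).ncard = 2}

/-- `S` is a `K_{1,k+1}`-isolating set of `G`: every vertex of `G - N[S]`
has at most `k` neighbors in `G - N[S]`. -/
def IsKIsolating {V : Type*} (G : SimpleGraph V) (k : ℕ) (S : Set V) : Prop :=
  ∀ v ∈ (closedNbhd G S)ᶜ, (G.neighborSet v ∩ (closedNbhd G S)ᶜ).ncard ≤ k

/-- The `K_{1,k+1}`-isolation number `ι_k(G)`. -/
noncomputable def iotaK {V : Type*} (G : SimpleGraph V) (k : ℕ) : ℕ :=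
  sInf {m | ∃ S : Set V, S.Finite ∧ IsKIsolating G k S ∧ S.ncard = m}

/-- `S` is an `H`-isolating set of `G`: the graph `G - N[S]` contains no
subgraph isomorphic to `H`. -/
def IsIsolating {V W : Type*} (G : SimpleGraph V) (H : SimpleGraph W) (S : Set V) : Prop :=
  ¬ ∃ f : W → ((closedNbhd G S)ᶜ : Set V), Function.Injective f ∧
      ∀ a b : W, H.Adj a b → G.Adj (f a).1 (f b).1

/-- The `H`-isolation number `ι(G, H)`. -/
noncomputable def isolationNumber {V W : Type*} (G : SimpleGraph V) (H : SimpleGraph W) : ℕ :=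
  sInf {m | ∃ S : Set V, S.Finite ∧ IsIsolating G H S ∧ S.ncard = m}

/-- The domination number `γ(G)`. -/
noncomputable def dominationNumber {V : Type*} (G : SimpleGraph V) : ℕ :=
  sInf {m | ∃ S : Set V, S.Finite ∧ closedNbhd G S = Set.univ ∧ S.ncard = m}


section Triangulation

variable {α : Type*} [LinearOrder α]

/-- The elements of `A` strictly between `x` and `y`. -/
def between (A : Finset α) (x y : α) : Finset α := A.filter (fun w => x < w ∧ w < y)

lemma mem_between {A : Finset α} {x y w : α} :
    w ∈ between A x y ↔ w ∈ A ∧ x < w ∧ w < y := by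
  simp [between]

/-- No two edges of `G` with ends in `A` cross. -/
def NonCrossing (G : SimpleGraph α) (A : Finset α) : Prop :=
  ∀ a ∈ A, ∀ c ∈ A, ∀ b ∈ A, ∀ d ∈ A, a < c → c < b → b < d → G.Adj a b → ¬ G.Adj c d

/-- `G` restricts to a triangulated polygon on `A`, the vertices being placed around the polygon
in increasing order. -/
structure IsTri (G : SimpleGraph α) (A : Finset α) : Prop where
  nonCrossing : NonCrossing G A
  top : ∀ x ∈ A, ∀ y ∈ A, x < y → (∀ w ∈ A, x ≤ w ∧ w ≤ y) → G.Adj x y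
  apex : ∀ x ∈ A, ∀ y ∈ A, G.Adj x y → (∃ w ∈ A, x < w ∧ w < y) →
    ∃ z ∈ A, x < z ∧ z < y ∧ G.Adj x z ∧ G.Adj z y

/-- The vertex `v` lies in the closed neighborhood of `S`. -/
def Dominated (G : SimpleGraph α) (S : Finset α) (v : α) : Prop :=
  v ∈ S ∨ ∃ s ∈ S, G.Adj s v

open Classical in
/-- The closed neighborhood of `v` in the graph `G[A] - N[S]`. -/
noncomputable def residual (G : SimpleGraph α) (A S : Finset α) (v : α) : Finset α :=
  A.filter (fun u => ¬ Dominated G S u ∧ (u = v ∨ G.Adj v u))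

lemma mem_residual {G : SimpleGraph α} {A S : Finset α} {u v : α} :
    u ∈ residual G A S v ↔ u ∈ A ∧ ¬ Dominated G S u ∧ (u = v ∨ G.Adj v u) := by
  simp [residual]

/-- Every vertex of `G[A] - N[S]` has closed neighborhood of size at most `d`. -/
def Isolates (d : ℕ) (G : SimpleGraph α) (A S : Finset α) : Prop :=
  ∀ v ∈ A, ¬ Dominated G S v → (residual G A S v).card ≤ d

lemma IsTri.neighbor_mem_Icc {G : SimpleGraph α} {A : Finset α} (hT : IsTri G A) {x y u v : α}
    (hx : x ∈ A) (hy : y ∈ A) (hxy : G.Adj x y) (hu : u ∈ between A x y) (hv : v ∈ A)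
    (huv : G.Adj u v) : x ≤ v ∧ v ≤ y := by
  rw [mem_between] at hu
  obtain ⟨huA, h1, h2⟩ := hu
  constructor
  · by_contra! h
    exact hT.nonCrossing v hv x hx u huA y hy h h1 h2 huv.symm hxy
  · by_contra! h
    exact hT.nonCrossing x hx u huA y hy v hv h1 h2 h hxy huv

lemma IsTri.sdiff_between {G : SimpleGraph α} {A : Finset α} (hT : IsTri G A) {x y : α}
    (hx : x ∈ A) (hy : y ∈ A) (hxy : G.Adj x y) : IsTri G (A \ between A x y) where
  nonCrossing := by
    intro a ha c hc b hb d hd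
    simp only [Finset.mem_sdiff] at ha hc hb hd
    exact hT.nonCrossing a ha.1 c hc.1 b hb.1 d hd.1
  top := by
    intro a ha b hb hab h
    simp only [Finset.mem_sdiff, mem_between] at ha hb h
    refine hT.top a ha.1 b hb.1 hab fun w hw => ?_
    have h1 := h x (by simp [hx])
    have h2 := h y (by simp [hy])
    by_cases hw' : x < w ∧ w < y
    · exact ⟨h1.1.trans hw'.1.le, hw'.2.le.trans h2.2⟩
    · exact h w ⟨hw, fun h => hw' h.2⟩
  apex := by
    rintro a ha b hb hab ⟨w, hw, haw, hwb⟩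
    rw [Finset.mem_sdiff] at ha hb hw
    obtain ⟨z, hz, haz, hzb, h1, h2⟩ := hT.apex a ha.1 b hb.1 hab ⟨w, hw.1, haw, hwb⟩
    refine ⟨z, ?_, haz, hzb, h1, h2⟩
    rw [Finset.mem_sdiff]
    refine ⟨hz, fun hzI => hw.2 ?_⟩
    have := hT.neighbor_mem_Icc hx hy hxy hzI ha.1 h1.symm
    have := hT.neighbor_mem_Icc hx hy hxy hzI hb.1 h2
    rw [mem_between]
    exact ⟨hw.1, by order, by order⟩

/-- The graph obtained from `G` by giving `x` all the neighbors of `y`. -/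
def mergeInto (G : SimpleGraph α) (x y : α) : SimpleGraph α where
  Adj a b := a ≠ b ∧ (G.Adj a b ∨ (a = x ∧ G.Adj y b) ∨ (b = x ∧ G.Adj a y))
  symm := ⟨by
    rintro a b ⟨h, h1 | h1 | h1⟩
    · exact ⟨h.symm, Or.inl h1.symm⟩
    · exact ⟨h.symm, Or.inr (Or.inr ⟨h1.1, h1.2.symm⟩)⟩
    · exact ⟨h.symm, Or.inr (Or.inl ⟨h1.1, h1.2.symm⟩)⟩⟩
  loopless := ⟨fun a h => h.1 rfl⟩

lemma mergeInto_lift {β : Type*} {G : SimpleGraph β} {A : Finset β} {x y : β} (hy : y ∈ A)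
    {a b : β} (ha : a ∈ A) (hb : b ∈ A) (h : (mergeInto G x y).Adj a b) :
    ∃ a' ∈ A, ∃ b' ∈ A, (a' = a ∨ a = x ∧ a' = y) ∧ (b' = b ∨ b = x ∧ b' = y) ∧ G.Adj a' b' := by
  obtain ⟨_, h1 | h1 | h1⟩ := h
  · exact ⟨a, ha, b, hb, by simp, by simp, h1⟩
  · exact ⟨y, hy, b, hb, by simp [h1.1], by simp, h1.2⟩
  · exact ⟨a, ha, y, hy, by simp, by simp [h1.1], h1.2⟩

/-- Contracting a boundary edge of a triangulated polygon gives a triangulated polygon. -/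
lemma IsTri.contract {G : SimpleGraph α} {A : Finset α} (hT : IsTri G A) {x y : α}
    (hx : x ∈ A) (hy : y ∈ A) (hxy : x < y) (hcons : ∀ w ∈ A, ¬ (x < w ∧ w < y)) :
    IsTri (mergeInto G x y) (A.erase y) := by
  have key : ∀ p ∈ A.erase y, ∀ q ∈ A.erase y, p < q → ∀ p' q', (p' = p ∨ p = x ∧ p' = y) →
      (q' = q ∨ q = x ∧ q' = y) → p' < q' := by
    intro p hp q hq hpq p' q' hp' hq'
    rw [Finset.mem_erase] at hp hq
    have := hcons q hq.2
    grind
  refine ⟨?_, ?_, ?_⟩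
  · intro a ha c hc b hb d hd hac hcb hbd hab hcd
    obtain ⟨a', ha', b', hb', h1, h2, h3⟩ :=
      mergeInto_lift hy (Finset.mem_of_mem_erase ha) (Finset.mem_of_mem_erase hb) hab
    obtain ⟨c', hc', d', hd', h4, h5, h6⟩ :=
      mergeInto_lift hy (Finset.mem_of_mem_erase hc) (Finset.mem_of_mem_erase hd) hcd
    exact hT.nonCrossing a' ha' c' hc' b' hb' d' hd' (key a ha c hc hac _ _ h1 h4)
      (key c hc b hb hcb _ _ h4 h2) (key b hb d hd hbd _ _ h2 h5) h3 h6
  · intro a ha b hb hab h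
    have hxA : x ∈ A.erase y := by simp [hx, hxy.ne]
    rw [Finset.mem_erase] at ha hb
    have hax := h x hxA
    refine ⟨hab.ne, ?_⟩
    by_cases hby : b < y
    · have hbx : b = x := by
        have := hcons b hb.2
        grind
      refine Or.inr (Or.inr ⟨hbx, hT.top a ha.2 y hy (hab.trans hby) fun w hw => ?_⟩)
      by_cases hwy : w = y
      · subst hwy; exact ⟨(hab.trans hby).le, le_rfl⟩
      · have := h w (by simp [hw, hwy])
        exact ⟨this.1, this.2.trans hby.le⟩
    · refine Or.inl (hT.top a ha.2 b hb.2 hab fun w hw => ?_)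
      by_cases hwy : w = y
      · subst hwy; exact ⟨hax.1.trans hxy.le, not_lt.1 hby⟩
      · exact h w (by simp [hw, hwy])
  · rintro a ha b hb hab ⟨w, hw, haw, hwb⟩
    obtain ⟨a', ha', b', hb', h1, h2, h3⟩ :=
      mergeInto_lift hy (Finset.mem_of_mem_erase ha) (Finset.mem_of_mem_erase hb) hab
    have haw' : a' < w := key a ha w hw haw _ _ h1 (Or.inl rfl)
    have hwb' : w < b' := key w hw b hb hwb _ _ (Or.inl rfl) h2
    have hwA := Finset.mem_of_mem_erase hw
    obtain ⟨z, hz, haz, hzb, h4, h5⟩ := hT.apex a' ha' b' hb' h3 ⟨w, hwA, haw', hwb'⟩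
    rw [Finset.mem_erase] at ha hb hw
    by_cases hzy : z = y
    · subst hzy
      have ea : a' = a := by grind
      have eb : b' = b := by grind
      subst ea eb
      by_cases hax : a' = x
      · subst hax
        have hzw : z < w := by
          have := hcons w hwA
          grind
        obtain ⟨z₂, hz₂, hz1, hz2, h6, h7⟩ := hT.apex z hz b' hb.2 h5 ⟨w, hwA, hzw, hwb'⟩
        refine ⟨z₂, by simp [hz₂, hz1.ne'], hxy.trans hz1, hz2, ⟨?_, ?_⟩, hz2.ne, Or.inl h7⟩
        · exact (hxy.trans hz1).ne
        · exact Or.inr (Or.inl ⟨rfl, h6⟩)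
      · have hax' : a' < x := by
          have := hcons a' ha.2
          grind
        refine ⟨x, by simp [hx, hxy.ne], hax', hxy.trans hzb, ⟨hax, ?_⟩, ?_, ?_⟩
        · exact Or.inr (Or.inr ⟨rfl, h4⟩)
        · exact (hxy.trans hzb).ne
        · exact Or.inr (Or.inl ⟨rfl, h5⟩)
    · by_cases hzx : z = b
      · have hbx : b = x := by grind
        have ea : a' = a := by grind
        subst hzx hbx ea
        obtain ⟨z₂, hz₂, hz1, hz2, h6, h7⟩ := hT.apex a' ha.2 z hz h4 ⟨w, hwA, haw, hwb⟩
        exact ⟨z₂, by simp [hz₂, (hz2.trans hxy).ne], hz1, hz2, ⟨hz1.ne, Or.inl h6⟩,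
          hz2.ne, Or.inl h7⟩
      · have hz1 : a < z := by grind
        have hz2 : z < b := by
          have := hcons z hz
          grind
        refine ⟨z, by simp [hz, hzy], hz1, hz2, ⟨hz1.ne, ?_⟩, hz2.ne, ?_⟩
        · rcases h1 with rfl | ⟨h1, rfl⟩
          · exact Or.inl h4
          · exact Or.inr (Or.inl ⟨h1, h4⟩)
        · rcases h2 with rfl | ⟨h2, rfl⟩
          · exact Or.inl h5
          · exact Or.inr (Or.inr ⟨h2, h5⟩)

/-- An edge with some vertex of the polygon on its outer side has a common neighbor there. -/
lemma IsTri.exists_outer_apex {G : SimpleGraph α} {A : Finset α} (hT : IsTri G A) {x y : α}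
    (hx : x ∈ A) (hy : y ∈ A) (hlt : x < y) (hxy : G.Adj x y)
    (hout : ∃ w ∈ A, w < x ∨ y < w) :
    ∃ w ∈ A, (w < x ∨ y < w) ∧ G.Adj x w ∧ G.Adj y w := by
  classical
  let P : Finset (α × α) := (A ×ˢ A).filter fun p =>
    G.Adj p.1 p.2 ∧ p.1 ≤ x ∧ y ≤ p.2 ∧ (p.1 < x ∨ y < p.2)
  have hA : A.Nonempty := ⟨x, hx⟩
  have hP : P.Nonempty := by
    refine ⟨(A.min' hA, A.max' hA), ?_⟩
    have h1 := A.min'_le x hx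
    have h2 := A.le_max' y hy
    simp only [P, Finset.mem_filter, Finset.mem_product]
    refine ⟨⟨A.min'_mem hA, A.max'_mem hA⟩, hT.top _ (A.min'_mem hA) _ (A.max'_mem hA) (by order)
      fun w hw => ⟨A.min'_le w hw, A.le_max' w hw⟩, h1, h2, ?_⟩
    obtain ⟨w, hw, h | h⟩ := hout
    · exact Or.inl ((A.min'_le w hw).trans_lt h)
    · exact Or.inr (h.trans_le (A.le_max' w hw))
  obtain ⟨⟨a, b⟩, hab, hmin⟩ := P.exists_min_image (fun p => (between A p.1 p.2).card) hP
  simp only [P, Finset.mem_filter, Finset.mem_product] at hab hmin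
  obtain ⟨⟨ha, hb⟩, hadj, hax, hyb, hstr⟩ := hab
  have hw : ∃ w ∈ A, a < w ∧ w < b := by
    rcases hstr with h | h
    · exact ⟨x, hx, h, by order⟩
    · exact ⟨y, hy, by order, h⟩
  obtain ⟨z, hz, haz, hzb, h1, h2⟩ := hT.apex a ha b hb hadj hw
  have hzxy : z ≤ x ∨ y ≤ z := by
    by_contra! h
    have hzI : z ∈ between A x y := mem_between.2 ⟨hz, h⟩
    have := hT.neighbor_mem_Icc hx hy hxy hzI ha h1.symm
    have := hT.neighbor_mem_Icc hx hy hxy hzI hb h2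
    rcases hstr with h | h <;> order
  have hlt' : ∀ p q, a ≤ p → q ≤ b → ¬ (p < z ∧ z < q) →
      (between A p q).card < (between A a b).card := by
    intro p q hp hq hn
    refine Finset.card_lt_card ⟨fun w hw => ?_, fun hsub => ?_⟩
    · rw [mem_between] at hw ⊢
      exact ⟨hw.1, by order, by order⟩
    · exact hn (mem_between.1 (hsub (mem_between.2 ⟨hz, haz, hzb⟩))).2
  rcases hzxy with h | h
  · by_cases hs : z < x ∨ y < b
    · have : (between A a b).card ≤ (between A z b).card := hmin (z, b) ⟨⟨hz, hb⟩, h2, h, hyb, hs⟩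
      have := hlt' z b haz.le le_rfl (by simp)
      omega
    · push Not at hs
      obtain rfl : z = x := by order
      obtain rfl : b = y := by order
      exact ⟨a, ha, Or.inl haz, h1.symm, hadj.symm⟩
  · by_cases hs : a < x ∨ y < z
    · have : (between A a b).card ≤ (between A a z).card := hmin (a, z) ⟨⟨ha, hz⟩, h1, hax, h, hs⟩
      have := hlt' a z le_rfl hzb.le (by simp)
      omega
    · push Not at hs
      obtain rfl : z = y := by order
      obtain rfl : a = x := by order
      exact ⟨b, hb, Or.inr hzb, hadj, h2⟩

lemma IsTri.card_residual_le {G : SimpleGraph α} {A : Finset α} (hT : IsTri G A) {d : ℕ}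
    {x y v : α} {S T : Finset α} (hx : x ∈ A) (hy : y ∈ A) (hxy : G.Adj x y)
    (hSx : Dominated G S x) (hSy : Dominated G S y) (hTI : T ⊆ between A x y)
    (hTS : ∀ w ∈ T, Dominated G S w) (hcard : (between A x y).card ≤ T.card + d)
    (hv : v ∈ between A x y) : (residual G A S v).card ≤ d := by
  have hsub : residual G A S v ⊆ between A x y \ T := by
    intro u hu
    rw [mem_residual] at hu
    obtain ⟨huA, hu, huv⟩ := hu
    rw [Finset.mem_sdiff]
    refine ⟨?_, fun h => hu (hTS u h)⟩
    rcases huv with rfl | huv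
    · exact hv
    · have := hT.neighbor_mem_Icc hx hy hxy hv huA huv
      have hux : u ≠ x := by rintro rfl; exact hu hSx
      have huy : u ≠ y := by rintro rfl; exact hu hSy
      exact mem_between.2 ⟨huA, by order, by order⟩
  have := Finset.card_le_card hsub
  rw [Finset.card_sdiff_of_subset hTI] at this
  omega

/-- The apex `z` of an edge `xy` isolates the inner side of `xy`, if both of the other sides of
the triangle `xyz` cut off few vertices. -/
lemma IsTri.card_residual_le_of_apex {G : SimpleGraph α} {A : Finset α} (hT : IsTri G A) {d : ℕ}
    {x y z v : α} {S : Finset α} (hx : x ∈ A) (hy : y ∈ A) (hz : z ∈ A)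
    (hxz : G.Adj x z) (hzy : G.Adj z y) (hzS : z ∈ S)
    (hl : (between A x z).card ≤ d + 1) (hr : (between A z y).card ≤ d + 1)
    (hv : v ∈ between A x y) (hvS : ¬ Dominated G S v) : (residual G A S v).card ≤ d := by
  have hSx : Dominated G S x := Or.inr ⟨z, hzS, hxz.symm⟩
  have hSy : Dominated G S y := Or.inr ⟨z, hzS, hzy⟩
  have hSz : Dominated G S z := Or.inl hzS
  have hvz : v ≠ z := by rintro rfl; exact hvS hSz
  rw [mem_between] at hv
  rcases lt_or_gt_of_ne hvz with h | h
  · obtain ⟨w, hw, h1, h2, h3, h4⟩ := hT.apex x hx z hz hxz ⟨v, hv.1, hv.2.1, h⟩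
    refine hT.card_residual_le hx hz hxz hSx hSz (T := {w}) ?_ ?_ ?_
      (mem_between.2 ⟨hv.1, hv.2.1, h⟩)
    · simp [mem_between, hw, h1, h2]
    · exact fun t ht => Finset.mem_singleton.1 ht ▸ Or.inr ⟨z, hzS, h4.symm⟩
    · rw [Finset.card_singleton]; omega
  · obtain ⟨w, hw, h1, h2, h3, h4⟩ := hT.apex z hz y hy hzy ⟨v, hv.1, h, hv.2.2⟩
    refine hT.card_residual_le hz hy hzy hSz hSy (T := {w}) ?_ ?_ ?_
      (mem_between.2 ⟨hv.1, h, hv.2.2⟩)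
    · simp [mem_between, hw, h1, h2]
    · exact fun t ht => Finset.mem_singleton.1 ht ▸ Or.inr ⟨z, hzS, h3⟩
    · rw [Finset.card_singleton]; omega

/-- One of the ends of an edge that cuts off at least two vertices has two neighbors
among these. -/
lemma IsTri.exists_end_two_neighbors {G : SimpleGraph α} {A : Finset α} (hT : IsTri G A)
    {x y : α} (hx : x ∈ A) (hy : y ∈ A) (hxy : G.Adj x y) (h2 : 2 ≤ (between A x y).card) :
    ∃ u, (u = x ∨ u = y) ∧ ∃ T ⊆ between A x y, T.card = 2 ∧ ∀ w ∈ T, G.Adj u w := by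
  obtain ⟨w, hw⟩ : (between A x y).Nonempty := Finset.card_pos.1 (by omega)
  obtain ⟨z, hz, hxz, hzy, h3, h4⟩ := hT.apex x hx y hy hxy ⟨w, mem_between.1 hw⟩
  obtain ⟨v, hv, hvz⟩ := Finset.exists_mem_ne (by omega) z (s := between A x y)
  rw [mem_between] at hv
  rcases lt_or_gt_of_ne hvz with h | h
  · obtain ⟨t, ht, h5, h6, h7, h8⟩ := hT.apex x hx z hz h3 ⟨v, hv.1, hv.2.1, h⟩
    refine ⟨x, Or.inl rfl, {t, z}, ?_, Finset.card_pair h6.ne, by simp [h7, h3]⟩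
    simp only [Finset.insert_subset_iff, Finset.singleton_subset_iff, mem_between]
    exact ⟨⟨ht, h5, by order⟩, hz, hxz, hzy⟩
  · obtain ⟨t, ht, h5, h6, h7, h8⟩ := hT.apex z hz y hy h4 ⟨v, hv.1, h, hv.2.2⟩
    refine ⟨y, Or.inr rfl, {z, t}, ?_, Finset.card_pair h5.ne, by simp [h8.symm, h4.symm]⟩
    simp only [Finset.insert_subset_iff, Finset.singleton_subset_iff, mem_between]
    exact ⟨⟨hz, hxz, hzy⟩, ht, by order, h6⟩

lemma card_between_add {A : Finset α} {x y z : α} (hz : z ∈ A) (hxz : x < z) (hzy : z < y) :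
    (between A x y).card = (between A x z).card + (between A z y).card + 1 := by
  have h : between A x y = insert z (between A x z ∪ between A z y) := by
    ext w
    simp only [mem_between, Finset.mem_insert, Finset.mem_union]
    grind
  rw [h, Finset.card_insert_of_notMem (by simp [mem_between]), Finset.card_union_of_disjoint]
  rw [Finset.disjoint_left]
  intro w hw hw'
  rw [mem_between] at hw hw'
  order

lemma between_subset (A : Finset α) (x y : α) : between A x y ⊆ A := Finset.filter_subset _ _

lemma IsTri.residual_subset_sdiff {G : SimpleGraph α} {A : Finset α} (hT : IsTri G A)
    {x y v : α} {S : Finset α} (hx : x ∈ A) (hy : y ∈ A) (hxy : G.Adj x y)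
    (hSx : Dominated G S x) (hSy : Dominated G S y) (hv : v ∈ A \ between A x y)
    (hvS : ¬ Dominated G S v) :
    residual G A S v ⊆ residual G (A \ between A x y) S v := by
  rw [Finset.mem_sdiff] at hv
  intro u hu
  rw [mem_residual] at hu ⊢
  refine ⟨Finset.mem_sdiff.2 ⟨hu.1, fun huI => ?_⟩, hu.2⟩
  rcases hu.2.2 with rfl | h
  · exact hv.2 huI
  · have := hT.neighbor_mem_Icc hx hy hxy huI hv.1 h.symm
    have hvx : v ≠ x := by rintro rfl; exact hvS hSx
    have hvy : v ≠ y := by rintro rfl; exact hvS hSy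
    exact hv.2 (mem_between.2 ⟨hv.1, by order, by order⟩)

/-- An edge cutting off at least `t` vertices, with as few vertices cut off as possible. -/
lemma IsTri.exists_minimal_edge {G : SimpleGraph α} {A : Finset α} (hT : IsTri G A) {t : ℕ}
    (ht : t + 2 ≤ A.card) :
    ∃ x ∈ A, ∃ y ∈ A, x < y ∧ G.Adj x y ∧ t ≤ (between A x y).card ∧
      ∀ a ∈ A, ∀ b ∈ A, a < b → G.Adj a b → t ≤ (between A a b).card →
        (between A x y).card ≤ (between A a b).card := by
  classical
  let P : Finset (α × α) := (A ×ˢ A).filter fun p =>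
    p.1 < p.2 ∧ G.Adj p.1 p.2 ∧ t ≤ (between A p.1 p.2).card
  have hA : A.Nonempty := Finset.card_pos.1 (by omega)
  have hP : P.Nonempty := by
    refine ⟨(A.min' hA, A.max' hA), ?_⟩
    have hlt : A.min' hA < A.max' hA := A.min'_lt_max'_of_card (by omega)
    simp only [P, Finset.mem_filter, Finset.mem_product]
    refine ⟨⟨A.min'_mem hA, A.max'_mem hA⟩, hlt, hT.top _ (A.min'_mem hA) _ (A.max'_mem hA) hlt
      fun w hw => ⟨A.min'_le w hw, A.le_max' w hw⟩, ?_⟩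
    have hsub : A ⊆ insert (A.min' hA) (insert (A.max' hA) (between A (A.min' hA) (A.max' hA))) := by
      intro w hw
      have h1 := A.min'_le w hw
      have h2 := A.le_max' w hw
      simp only [Finset.mem_insert, mem_between]
      rcases h1.eq_or_lt with h | h
      · exact Or.inl h.symm
      · rcases h2.eq_or_lt with h' | h'
        · exact Or.inr (Or.inl h')
        · exact Or.inr (Or.inr ⟨hw, h, h'⟩)
    have h3 := Finset.card_le_card hsub
    have h4 := Finset.card_insert_le (A.min' hA)
      (insert (A.max' hA) (between A (A.min' hA) (A.max' hA)))
    have h5 := Finset.card_insert_le (A.max' hA) (between A (A.min' hA) (A.max' hA))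
    omega
  obtain ⟨⟨x, y⟩, hxy, hmin⟩ := P.exists_min_image (fun p => (between A p.1 p.2).card) hP
  simp only [P, Finset.mem_filter, Finset.mem_product] at hxy hmin
  exact ⟨x, hxy.1.1, y, hxy.1.2, hxy.2.1, hxy.2.2.1, hxy.2.2.2,
    fun a ha b hb h1 h2 h3 => hmin (a, b) ⟨⟨ha, hb⟩, h1, h2, h3⟩⟩

lemma card_residual_le_of_subset {G : SimpleGraph α} {A S T : Finset α} {v : α} {d : ℕ}
    (hT : T ⊆ A) (hTS : ∀ w ∈ T, Dominated G S w) (h : A.card ≤ T.card + d) :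
    (residual G A S v).card ≤ d := by
  have hsub : residual G A S v ⊆ A \ T := by
    intro u hu
    rw [mem_residual] at hu
    exact Finset.mem_sdiff.2 ⟨hu.1, fun h => hu.2.1 (hTS u h)⟩
  have := Finset.card_le_card hsub
  rw [Finset.card_sdiff_of_subset hT] at this
  omega

/-- In a small triangulated polygon one vertex suffices. -/
lemma IsTri.exists_singleton_isolates {G : SimpleGraph α} {A : Finset α} (hT : IsTri G A) {d : ℕ}
    (h1 : d + 3 ≤ A.card) (h2 : A.card < 2 * (d + 3)) : ∃ u ∈ A, Isolates d G A {u} := by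
  obtain ⟨x, hx, y, hy, hlt, hxy, hc, hmin⟩ :=
    hT.exists_minimal_edge (t := min (d + 2) (A.card - 2)) (by omega)
  set c := (between A x y).card with hcdef
  have hsplit : (A \ between A x y).card = A.card - c :=
    Finset.card_sdiff_of_subset (between_subset A x y)
  have hxo : x ∈ A \ between A x y := by simp [hx, mem_between]
  have hyo : y ∈ A \ between A x y := by simp [hy, mem_between]
  have htwo : 2 ≤ (A \ between A x y).card := by
    rw [← Finset.card_pair hlt.ne]
    exact Finset.card_le_card (by simp [Finset.insert_subset_iff, hxo, hyo])
  by_cases hcd : c ≤ d + 2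
  · by_cases hc2 : c ≤ 1
    · obtain ⟨w, hw⟩ : (between A x y).Nonempty := Finset.card_pos.1 (by omega)
      obtain ⟨z, hz, hxz, hzy, h3, h4⟩ := hT.apex x hx y hy hxy ⟨w, mem_between.1 hw⟩
      refine ⟨x, hx, fun v _ _ => card_residual_le_of_subset (T := {x, y, z}) ?_ ?_ ?_⟩
      · simp [Finset.insert_subset_iff, hx, hy, hz]
      · simp [Dominated, hxy, h3]
      · rw [Finset.card_eq_three.2 ⟨x, y, z, hlt.ne, hxz.ne, hzy.ne', rfl⟩]
        omega
    obtain ⟨u, hu, T, hTI, hTc, hTu⟩ := hT.exists_end_two_neighbors hx hy hxy (by omega)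
    have huA : u ∈ A := by rcases hu with rfl | rfl <;> assumption
    have hSx : Dominated G {u} x := by
      rcases hu with rfl | rfl
      · simp [Dominated]
      · simp [Dominated, hxy.symm]
    have hSy : Dominated G {u} y := by
      rcases hu with rfl | rfl
      · simp [Dominated, hxy]
      · simp [Dominated]
    refine ⟨u, huA, fun v hv hvS => ?_⟩
    by_cases hvI : v ∈ between A x y
    · exact hT.card_residual_le hx hy hxy hSx hSy hTI
        (fun w hw => Or.inr ⟨u, by simp, hTu w hw⟩) (by omega) hvI
    · have hvo : v ∈ A \ between A x y := Finset.mem_sdiff.2 ⟨hv, hvI⟩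
      have hsub := hT.residual_subset_sdiff hx hy hxy hSx hSy hvo hvS
      refine (Finset.card_le_card hsub).trans ?_
      have hvx : v ≠ x := by rintro rfl; exact hvS hSx
      have hvy : v ≠ y := by rintro rfl; exact hvS hSy
      have hvout : v < x ∨ y < v := by
        by_contra! h
        exact hvI (mem_between.2 ⟨hv, by order, by order⟩)
      obtain ⟨w, hw, hwo, h3, h4⟩ := hT.exists_outer_apex hx hy hlt hxy ⟨v, hv, hvout⟩
      have hwo' : w ∈ A \ between A x y := by
        rw [Finset.mem_sdiff, mem_between]
        refine ⟨hw, fun h => ?_⟩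
        rcases hwo with h' | h' <;> order
      refine card_residual_le_of_subset (T := {x, y, w}) ?_ ?_ ?_
      · simp only [Finset.insert_subset_iff, Finset.singleton_subset_iff]
        exact ⟨hxo, hyo, hwo'⟩
      · have hSw : Dominated G {u} w := by
          rcases hu with rfl | rfl
          · simp [Dominated, h3]
          · simp [Dominated, h4]
        simp [hSx, hSy, hSw]
      · rw [Finset.card_eq_three.2 ⟨x, y, w, hlt.ne, h3.ne, h4.ne, rfl⟩]
        omega
  · obtain ⟨w, hw⟩ : (between A x y).Nonempty := Finset.card_pos.1 (by omega)
    obtain ⟨z, hz, hxz, hzy, h3, h4⟩ := hT.apex x hx y hy hxy ⟨w, mem_between.1 hw⟩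
    have hadd := card_between_add hz hxz hzy
    have hl := hmin x hx z hz hxz h3
    have hr := hmin z hz y hy hzy h4
    have hSx : Dominated G {z} x := by simp [Dominated, h3.symm]
    have hSy : Dominated G {z} y := by simp [Dominated, h4]
    refine ⟨z, hz, fun v hv hvS => ?_⟩
    by_cases hvI : v ∈ between A x y
    · exact hT.card_residual_le_of_apex hx hy hz h3 h4 (by simp) (by omega) (by omega) hvI hvS
    · have hvo : v ∈ A \ between A x y := Finset.mem_sdiff.2 ⟨hv, hvI⟩
      refine (Finset.card_le_card (hT.residual_subset_sdiff hx hy hxy hSx hSy hvo hvS)).trans ?_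
      refine card_residual_le_of_subset (T := {x, y}) ?_ ?_ ?_
      · simp only [Finset.insert_subset_iff, Finset.singleton_subset_iff]
        exact ⟨hxo, hyo⟩
      · simp [hSx, hSy]
      · rw [Finset.card_pair hlt.ne]
        omega

lemma Dominated.mono {β : Type*} {G : SimpleGraph β} {S T : Finset β} {v : β} (h : Dominated G S v)
    (hST : S ⊆ T) : Dominated G T v := by
  rcases h with h | ⟨s, hs, h⟩
  · exact Or.inl (hST h)
  · exact Or.inr ⟨s, hST hs, h⟩

lemma residual_anti {G : SimpleGraph α} {A S T : Finset α} {v : α} (hST : S ⊆ T) :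
    residual G A T v ⊆ residual G A S v := by
  intro u hu
  rw [mem_residual] at hu ⊢
  exact ⟨hu.1, fun h => hu.2.1 (h.mono hST), hu.2.2⟩

theorem IsTri.exists_isolates {d n : ℕ} {G : SimpleGraph α} {A : Finset α} (hT : IsTri G A)
    (hn : A.card = n) (hd : d + 3 ≤ n) :
    ∃ S ⊆ A, (d + 3) * S.card ≤ n ∧ Isolates d G A S := by
  induction n using Nat.strong_induction_on generalizing G A with
  | _ n ih =>
  subst hn
  by_cases hbig : A.card < 2 * (d + 3)
  · obtain ⟨u, hu, hiso⟩ := hT.exists_singleton_isolates hd hbig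
    exact ⟨{u}, by simpa using hu, by simpa using hd, hiso⟩
  push Not at hbig
  obtain ⟨x, hx, y, hy, hlt, hxy, hc, hmin⟩ := hT.exists_minimal_edge (t := d + 2) (by omega)
  set c := (between A x y).card with hcdef
  have hsplit : (A \ between A x y).card = A.card - c :=
    Finset.card_sdiff_of_subset (between_subset A x y)
  have hcA : c ≤ A.card := Finset.card_le_card (between_subset A x y)
  have hxo : x ∈ A \ between A x y := by simp [hx, mem_between]
  have hyo : y ∈ A \ between A x y := by simp [hy, mem_between]
  have hT' := hT.sdiff_between hx hy hxy
  rcases hc.eq_or_lt with hc | hc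
  · obtain ⟨u, hu, T, hTI, hTc, hTu⟩ := hT.exists_end_two_neighbors hx hy hxy (by omega)
    have huA : u ∈ A := by rcases hu with rfl | rfl <;> assumption
    have hT₂ := hT'.contract hxo hyo hlt (fun w hw h => by
      rw [Finset.mem_sdiff] at hw
      exact hw.2 (mem_between.2 ⟨hw.1, h⟩))
    have hcard : ((A \ between A x y).erase y).card = A.card - (d + 3) := by
      rw [Finset.card_erase_of_mem hyo]
      omega
    obtain ⟨S, hSA, hS, hiso⟩ := ih _ (by omega) hT₂ hcard (by omega)
    have hSA' : S ⊆ A := fun s hs => by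
      have := hSA hs
      rw [Finset.mem_erase, Finset.mem_sdiff] at this
      exact this.2.1
    obtain ⟨R, hRA, hRc, hSR, huR, hyR⟩ : ∃ R ⊆ A, R.card ≤ S.card + 1 ∧ S ⊆ R ∧ u ∈ R ∧
        (x ∈ S → y ∈ R) := by
      by_cases hxS : x ∈ S
      · refine ⟨insert y S, Finset.insert_subset hy hSA', Finset.card_insert_le _ _,
          Finset.subset_insert _ _, ?_, by simp⟩
        rcases hu with rfl | rfl <;> simp [hxS]
      · exact ⟨insert u S, Finset.insert_subset huA hSA', Finset.card_insert_le _ _,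
          Finset.subset_insert _ _, by simp, fun h => absurd h hxS⟩
    refine ⟨R, hRA, ?_, fun v hv hvR => ?_⟩
    · calc (d + 3) * R.card ≤ (d + 3) * (S.card + 1) := by gcongr
        _ ≤ A.card := by rw [mul_add]; omega
    have hRx : Dominated G R x := by
      rcases hu with rfl | rfl
      · exact Or.inl huR
      · exact Or.inr ⟨u, huR, hxy.symm⟩
    have hRy : Dominated G R y := by
      rcases hu with rfl | rfl
      · exact Or.inr ⟨u, huR, hxy⟩
      · exact Or.inl huR
    by_cases hvI : v ∈ between A x y
    · exact hT.card_residual_le hx hy hxy hRx hRy hTI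
        (fun w hw => Or.inr ⟨u, huR, hTu w hw⟩) (by omega) hvI
    have hvo : v ∈ A \ between A x y := Finset.mem_sdiff.2 ⟨hv, hvI⟩
    have hund : ∀ w, ¬ Dominated G R w → ¬ Dominated (mergeInto G x y) S w := by
      intro w hw hwS
      have hwx : w ≠ x := by rintro rfl; exact hw hRx
      rcases hwS with h | ⟨s, hs, hsw⟩
      · exact hw (Or.inl (hSR h))
      · obtain ⟨_, h | h | h⟩ := hsw
        · exact hw (Or.inr ⟨s, hSR hs, h⟩)
        · exact hw (Or.inr ⟨y, hyR (h.1 ▸ hs), h.2⟩)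
        · exact hwx h.1
    have hvy : v ≠ y := by rintro rfl; exact hvR hRy
    refine le_trans (Finset.card_le_card fun w hw => ?_)
      (hiso v (Finset.mem_erase.2 ⟨hvy, hvo⟩) (hund v hvR))
    have hw' := hT.residual_subset_sdiff hx hy hxy hRx hRy hvo hvR hw
    rw [mem_residual] at hw' ⊢
    have hwy : w ≠ y := by rintro rfl; exact hw'.2.1 hRy
    refine ⟨Finset.mem_erase.2 ⟨hwy, hw'.1⟩, hund w hw'.2.1, ?_⟩
    rcases hw'.2.2 with h | h
    · exact Or.inl h
    · exact Or.inr ⟨h.ne, Or.inl h⟩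
  · obtain ⟨w, hw⟩ : (between A x y).Nonempty := Finset.card_pos.1 (by omega)
    obtain ⟨z, hz, hxz, hzy, h3, h4⟩ := hT.apex x hx y hy hxy ⟨w, mem_between.1 hw⟩
    have hadd := card_between_add hz hxz hzy
    have hl := hmin x hx z hz hxz h3
    have hr := hmin z hz y hy hzy h4
    obtain ⟨S, hSA, hS, hiso⟩ : ∃ S ⊆ A \ between A x y, (d + 3) * (S.card + 1) ≤ A.card ∧
        Isolates d G (A \ between A x y) S := by
      by_cases hsmall : d + 3 ≤ (A \ between A x y).card
      · obtain ⟨S, hSA, hS, hiso⟩ := ih _ (by omega) hT' rfl hsmall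
        exact ⟨S, hSA, by rw [mul_add]; omega, hiso⟩
      · refine ⟨{x}, by simpa using hxo, by rw [Finset.card_singleton]; omega, fun v _ _ => ?_⟩
        refine card_residual_le_of_subset (T := {x, y}) ?_ ?_ ?_
        · simp only [Finset.insert_subset_iff, Finset.singleton_subset_iff]
          exact ⟨hxo, hyo⟩
        · simp [Dominated, hxy]
        · rw [Finset.card_pair hlt.ne]
          omega
    have hzS : z ∈ insert z S := Finset.mem_insert_self _ _
    have hSx : Dominated G (insert z S) x := Or.inr ⟨z, hzS, h3.symm⟩
    have hSy : Dominated G (insert z S) y := Or.inr ⟨z, hzS, h4⟩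
    refine ⟨insert z S, Finset.insert_subset hz (hSA.trans Finset.sdiff_subset), ?_,
      fun v hv hvS => ?_⟩
    · calc (d + 3) * (insert z S).card ≤ (d + 3) * (S.card + 1) := by
            gcongr; exact Finset.card_insert_le _ _
        _ ≤ A.card := hS
    by_cases hvI : v ∈ between A x y
    · exact hT.card_residual_le_of_apex hx hy hz h3 h4 hzS (by omega) (by omega) hvI hvS
    · have hvo : v ∈ A \ between A x y := Finset.mem_sdiff.2 ⟨hv, hvI⟩
      refine (Finset.card_le_card (hT.residual_subset_sdiff hx hy hxy hSx hSy hvo hvS)).trans ?_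
      refine (Finset.card_le_card (residual_anti (Finset.subset_insert z S))).trans ?_
      exact hiso v hvo fun h => hvS (h.mono (Finset.subset_insert z S))

lemma NonCrossing.mono {G : SimpleGraph α} {A B : Finset α} (h : NonCrossing G A) (hB : B ⊆ A) :
    NonCrossing G B :=
  fun a ha c hc b hb d hd => h a (hB ha) c (hB hc) b (hB hb) d (hB hd)

open Classical in
/-- The edges of `G[A]`, each given as an increasing pair. -/
noncomputable def edgesIn (G : SimpleGraph α) (A : Finset α) : Finset (α × α) :=
  (A ×ˢ A).filter fun p => p.1 < p.2 ∧ G.Adj p.1 p.2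

lemma mem_edgesIn {G : SimpleGraph α} {A : Finset α} {p : α × α} :
    p ∈ edgesIn G A ↔ (p.1 ∈ A ∧ p.2 ∈ A) ∧ p.1 < p.2 ∧ G.Adj p.1 p.2 := by
  simp [edgesIn]

lemma card_le_of_subset_insert {β : Type*} [DecidableEq β] {E X : Finset β} {p : β}
    (h : E ⊆ insert p X) : E.card ≤ X.card + 1 ∧ (p ∉ E → E.card ≤ X.card) := by
  refine ⟨(Finset.card_le_card h).trans (Finset.card_insert_le _ _), fun hp => ?_⟩
  refine Finset.card_le_card fun q hq => ?_
  rcases Finset.mem_insert.1 (h hq) with rfl | h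
  · exact absurd hq hp
  · exact h

/-- A noncrossing graph on `m ≥ 2` points has at most `2m - 3` edges, with equality only for
triangulated polygons. -/
lemma NonCrossing.card_edgesIn {G : SimpleGraph α} {A : Finset α} (hA : NonCrossing G A)
    (h2 : 2 ≤ A.card) :
    (edgesIn G A).card + 3 ≤ 2 * A.card ∧
      ((edgesIn G A).card + 3 = 2 * A.card → IsTri G A) := by
  induction hm : A.card using Nat.strong_induction_on generalizing A with
  | _ m ih =>
  subst hm
  have hne : A.Nonempty := Finset.card_pos.1 (by omega)
  obtain ⟨i, hi, hmin⟩ : ∃ i ∈ A, ∀ w ∈ A, i ≤ w :=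
    ⟨A.min' hne, A.min'_mem hne, fun w hw => A.min'_le w hw⟩
  obtain ⟨j, hj, hmax⟩ : ∃ j ∈ A, ∀ w ∈ A, w ≤ j :=
    ⟨A.max' hne, A.max'_mem hne, fun w hw => A.le_max' w hw⟩
  have htop : (i, j) ∈ edgesIn G A → ∀ x ∈ A, ∀ y ∈ A, x < y → (∀ w ∈ A, x ≤ w ∧ w ≤ y) →
      G.Adj x y := by
    intro hE x hx y hy _ h
    obtain rfl : x = i := le_antisymm (h i hi).1 (hmin x hx)
    obtain rfl : y = j := le_antisymm (hmax y hy) (h j hj).2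
    exact (mem_edgesIn.1 hE).2.2
  by_cases hex : ∃ z ∈ A, z < j ∧ i < z ∧ G.Adj i z
  · obtain ⟨z, hz, ⟨hzj, hiz, hadj⟩, hzmax⟩ : ∃ z ∈ A, (z < j ∧ i < z ∧ G.Adj i z) ∧
        ∀ w ∈ A, w < j → i < w → G.Adj i w → w ≤ z := by
      classical
      obtain ⟨z₀, hz₀, h₀⟩ := hex
      obtain ⟨z, hz, hm⟩ := (A.filter fun z => z < j ∧ i < z ∧ G.Adj i z).exists_max_image id
        ⟨z₀, by simpa using ⟨hz₀, h₀⟩⟩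
      simp only [Finset.mem_filter, id] at hz hm
      exact ⟨z, hz.1, hz.2, fun w hw h1 h2 h3 => hm w ⟨hw, h1, h2, h3⟩⟩
    set L := A.filter (· ≤ z) with hL
    set R := A.filter (z ≤ ·) with hR
    have hLA : L ⊆ A := Finset.filter_subset _ _
    have hRA : R ⊆ A := Finset.filter_subset _ _
    have hcard : L.card + R.card = A.card + 1 := by
      rw [← Finset.card_union_add_card_inter]
      have h1 : L ∪ R = A := by
        ext w
        simp only [hL, hR, Finset.mem_union, Finset.mem_filter]
        have := le_total w z
        tauto
      have h3 : L ∩ R = {z} := by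
        ext w
        simp only [hL, hR, Finset.mem_inter, Finset.mem_filter, Finset.mem_singleton]
        constructor
        · rintro ⟨h, h'⟩
          exact le_antisymm h.2 h'.2
        · rintro rfl
          exact ⟨⟨hz, le_rfl⟩, hz, le_rfl⟩
      rw [h1, h3, Finset.card_singleton]
    have hL2 : 2 ≤ L.card := by
      rw [← Finset.card_pair hiz.ne]
      exact Finset.card_le_card (by simp [Finset.insert_subset_iff, hL, hi, hz, hiz.le])
    have hR2 : 2 ≤ R.card := by
      rw [← Finset.card_pair hzj.ne]
      exact Finset.card_le_card (by simp [Finset.insert_subset_iff, hR, hj, hz, hzj.le])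
    have hE : edgesIn G A ⊆ insert (i, j) (edgesIn G L ∪ edgesIn G R) := by
      rintro ⟨a, b⟩ hp
      rw [mem_edgesIn] at hp
      obtain ⟨⟨ha, hb⟩, hab, h⟩ := hp
      simp only [Finset.mem_insert, Finset.mem_union, mem_edgesIn, hL, hR, Finset.mem_filter,
        Prod.mk.injEq]
      by_cases hbz : b ≤ z
      · exact Or.inr (Or.inl ⟨⟨⟨ha, by order⟩, hb, hbz⟩, hab, h⟩)
      by_cases hza : z ≤ a
      · exact Or.inr (Or.inr ⟨⟨⟨ha, hza⟩, hb, by order⟩, hab, h⟩)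
      push Not at hbz hza
      have hai : a = i := by
        by_contra hne
        exact hA i hi a ha z hz b hb (lt_of_le_of_ne (hmin a ha) (Ne.symm hne)) hza hbz hadj h
      subst hai
      refine Or.inl ⟨rfl, ?_⟩
      by_contra hne
      have := hzmax b hb (lt_of_le_of_ne (hmax b hb) hne) hab h
      order
    have hu := Finset.card_union_le (edgesIn G L) (edgesIn G R)
    obtain ⟨he, he'⟩ := card_le_of_subset_insert hE
    obtain ⟨hl, hlT⟩ := ih L.card (by omega) (hA.mono hLA) hL2 rfl
    obtain ⟨hr, hrT⟩ := ih R.card (by omega) (hA.mono hRA) hR2 rfl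
    refine ⟨by omega, fun heq => ?_⟩
    have hLT := hlT (by omega)
    have hRT := hrT (by omega)
    have hij : (i, j) ∈ edgesIn G A := by
      by_contra h
      have := he' h
      omega
    refine ⟨hA, htop hij, ?_⟩
    rintro a ha b hb hab ⟨w, hw, haw, hwb⟩
    have hp : (a, b) ∈ edgesIn G A := mem_edgesIn.2 ⟨⟨ha, hb⟩, haw.trans hwb, hab⟩
    have := hE hp
    simp only [Finset.mem_insert, Finset.mem_union, mem_edgesIn, Prod.mk.injEq] at this
    rcases this with ⟨rfl, rfl⟩ | ⟨⟨haL, hbL⟩, -⟩ | ⟨⟨haR, hbR⟩, -⟩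
    · refine ⟨z, hz, hiz, hzj, hadj, hRT.top z ?_ b ?_ hzj ?_⟩
      · simp [hR, hz]
      · simp [hR, hb, hzj.le]
      · intro v hv
        rw [hR, Finset.mem_filter] at hv
        exact ⟨hv.2, hmax v hv.1⟩
    · have hwL : w ∈ L := by
        rw [hL, Finset.mem_filter] at hbL ⊢
        exact ⟨hw, hwb.le.trans hbL.2⟩
      obtain ⟨t, ht, h⟩ := hLT.apex a haL b hbL hab ⟨w, hwL, haw, hwb⟩
      exact ⟨t, hLA ht, h⟩
    · have hwR : w ∈ R := by
        rw [hR, Finset.mem_filter] at haR ⊢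
        exact ⟨hw, haR.2.trans haw.le⟩
      obtain ⟨t, ht, h⟩ := hRT.apex a haR b hbR hab ⟨w, hwR, haw, hwb⟩
      exact ⟨t, hRA ht, h⟩
  · push Not at hex
    have hE : edgesIn G A ⊆ insert (i, j) (edgesIn G (A.erase i)) := by
      rintro ⟨a, b⟩ hp
      rw [mem_edgesIn] at hp
      obtain ⟨⟨ha, hb⟩, hab, h⟩ := hp
      simp only [Finset.mem_insert, mem_edgesIn, Finset.mem_erase, Prod.mk.injEq]
      by_cases hai : a = i
      · subst hai
        refine Or.inl ⟨rfl, ?_⟩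
        by_contra hne
        exact hex b hb (lt_of_le_of_ne (hmax b hb) hne) hab h
      · have := hmin a ha
        exact Or.inr ⟨⟨⟨hai, ha⟩, (this.trans_lt hab).ne', hb⟩, hab, h⟩
    obtain ⟨he, he'⟩ := card_le_of_subset_insert hE
    have hcard := Finset.card_erase_of_mem hi
    rcases h2.eq_or_lt with h2 | h2
    · have hempty : (edgesIn G (A.erase i)).card = 0 := by
        rw [Finset.card_eq_zero, Finset.eq_empty_iff_forall_notMem]
        intro p hp
        rw [mem_edgesIn] at hp
        exact hp.2.1.ne (Finset.card_le_one.1 (by omega) _ hp.1.1 _ hp.1.2)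
      refine ⟨by omega, fun heq => ?_⟩
      have hij : (i, j) ∈ edgesIn G A := by
        by_contra h
        have := he' h
        omega
      refine ⟨hA, htop hij, ?_⟩
      rintro a ha b hb hab ⟨w, hw, haw, hwb⟩
      have : ({a, w, b} : Finset α).card = 3 :=
        Finset.card_eq_three.2 ⟨a, w, b, haw.ne, (haw.trans hwb).ne, hwb.ne, rfl⟩
      have := Finset.card_le_card (show ({a, w, b} : Finset α) ⊆ A by
        simp [Finset.insert_subset_iff, ha, hw, hb])
      omega
    · obtain ⟨hr, -⟩ := ih _ (by omega) (hA.mono (Finset.erase_subset i A)) (by omega) rfl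
      exact ⟨by omega, fun h => by omega⟩

open Classical in
lemma card_edgesIn_le_erase (G : SimpleGraph α) (A : Finset α) (v : α) :
    (edgesIn G A).card ≤ (edgesIn G (A.erase v)).card + (A.filter (G.Adj v)).card := by
  have hE : edgesIn G A ⊆ edgesIn G (A.erase v) ∪
      (A.filter (G.Adj v)).image fun w => if v < w then (v, w) else (w, v) := by
    rintro ⟨a, b⟩ hp
    rw [mem_edgesIn] at hp
    obtain ⟨⟨ha, hb⟩, hab, h⟩ := hp
    simp only at ha hb hab h
    simp only [Finset.mem_union, mem_edgesIn, Finset.mem_erase, Finset.mem_image,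
      Finset.mem_filter]
    by_cases hav : a = v
    · subst hav
      exact Or.inr ⟨b, ⟨hb, h⟩, by simp [hab]⟩
    by_cases hbv : b = v
    · subst hbv
      exact Or.inr ⟨a, ⟨ha, h.symm⟩, by simp [hab.le]⟩
    exact Or.inl ⟨⟨⟨hav, ha⟩, hbv, hb⟩, hab, h⟩
  refine (Finset.card_le_card hE).trans ((Finset.card_union_le _ _).trans ?_)
  gcongr
  exact Finset.card_image_le

open Classical in
lemma card_edgesIn_le_sdiff (G : SimpleGraph α) (A B : Finset α) (t : ℕ)
    (hB : ∀ v ∈ B, (A.filter (G.Adj v)).card ≤ t) :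
    (edgesIn G A).card ≤ (edgesIn G (A \ B)).card + t * B.card := by
  induction B using Finset.induction_on with
  | empty => simp
  | insert v B hv ih =>
    have h1 := ih fun w hw => hB w (Finset.mem_insert_of_mem hw)
    have h2 := card_edgesIn_le_erase G (A \ B) v
    have h3 : ((A \ B).filter (G.Adj v)).card ≤ t :=
      (Finset.card_le_card (Finset.filter_subset_filter _ Finset.sdiff_subset)).trans
        (hB v (Finset.mem_insert_self _ _))
    have h4 : A \ insert v B = (A \ B).erase v := by
      ext w
      simp only [Finset.mem_sdiff, Finset.mem_insert, Finset.mem_erase]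
      tauto
    rw [h4, Finset.card_insert_of_notMem hv, mul_add]
    omega

open Classical in
/-- In a noncrossing graph with `2m - 3` edges on `m ≥ 4` points, vertices of degree two
are not adjacent. -/
lemma NonCrossing.not_adj_of_degree_two {G : SimpleGraph α} {A : Finset α} (hA : NonCrossing G A)
    (h4 : 4 ≤ A.card) (hE : 2 * A.card - 3 ≤ (edgesIn G A).card) {i j : α} (hi : i ∈ A)
    (hj : j ∈ A) (hdi : (A.filter (G.Adj i)).card = 2) (hdj : (A.filter (G.Adj j)).card = 2) :
    ¬ G.Adj i j := by
  intro hij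
  have h1 := card_edgesIn_le_erase G A i
  have h2 := card_edgesIn_le_erase G (A.erase i) j
  have h3 : (A.erase i).filter (G.Adj j) = (A.filter (G.Adj j)).erase i := by
    ext w
    simp only [Finset.mem_filter, Finset.mem_erase]
    tauto
  rw [h3, Finset.card_erase_of_mem (by simp [hi, hij.symm])] at h2
  have hc : ((A.erase i).erase j).card = A.card - 2 := by
    rw [Finset.card_erase_of_mem (by simp [hj, hij.ne']), Finset.card_erase_of_mem hi]
    omega
  have h5 := (hA.mono (((A.erase i).erase_subset j).trans (A.erase_subset i))).card_edgesIn
    (by omega)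
  omega

end Triangulation

lemma finNext_injective {n : ℕ} : Function.Injective (finNext : Fin n → Fin n) := by
  intro a b h
  have h' : (a.val + 1) % n = (b.val + 1) % n := congrArg Fin.val h
  have ha := a.isLt
  have hb := b.isLt
  ext
  rcases Nat.lt_or_ge (a.val + 1) n with h1 | h1 <;> rcases Nat.lt_or_ge (b.val + 1) n with h2 | h2
  · rw [Nat.mod_eq_of_lt h1, Nat.mod_eq_of_lt h2] at h'
    omega
  · rw [Nat.mod_eq_of_lt h1, show b.val + 1 = n by omega, Nat.mod_self] at h'
    omega
  · rw [Nat.mod_eq_of_lt h2, show a.val + 1 = n by omega, Nat.mod_self] at h'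
    omega
  · omega

lemma finNext_finNext_ne {n : ℕ} (hn : 3 ≤ n) (a : Fin n) : finNext (finNext a) ≠ a := by
  intro h
  have h' : ((a.val + 1) % n + 1) % n = a.val := congrArg Fin.val h
  have ha := a.isLt
  rcases Nat.lt_or_ge (a.val + 1) n with h1 | h1
  · rw [Nat.mod_eq_of_lt h1] at h'
    rcases Nat.lt_or_ge (a.val + 1 + 1) n with h2 | h2
    · rw [Nat.mod_eq_of_lt h2] at h'
      omega
    · rw [show a.val + 1 + 1 = n by omega, Nat.mod_self] at h'
      omega
  · rw [show a.val + 1 = n by omega, Nat.mod_self, Nat.mod_eq_of_lt (by omega)] at h'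
    omega

open Classical in
/-- The two neighbors of a vertex of degree two in a Hamiltonian cycle are its only neighbors. -/
lemma eq_finNext_of_degree_two {n : ℕ} (hn : 3 ≤ n) {H : SimpleGraph (Fin n)}
    (hH : ∀ i, H.Adj i (finNext i)) {b v : Fin n}
    (hb : (Finset.univ.filter (H.Adj b)).card = 2) (hv : H.Adj b v) :
    v = finNext b ∨ finNext v = b := by
  obtain ⟨p, rfl⟩ := Finite.surjective_of_injective finNext_injective b
  have hne : finNext (finNext p) ≠ p := finNext_finNext_ne hn p
  have heq : ({finNext (finNext p), p} : Finset (Fin n)) =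
      Finset.univ.filter (H.Adj (finNext p)) := by
    apply Finset.eq_of_subset_of_card_le
    · simp [Finset.insert_subset_iff, hH, (hH p).symm]
    · rw [hb, Finset.card_pair hne]
  have hmem : v ∈ Finset.univ.filter (H.Adj (finNext p)) := by simp [hv]
  rw [← heq] at hmem
  simp only [Finset.mem_insert, Finset.mem_singleton] at hmem
  exact hmem.imp id fun h => by rw [h]

open Classical in
lemma exists_isolates_of_cycle {n d : ℕ} (hn : 2 * d + 5 ≤ n) {H : SimpleGraph (Fin n)}
    (hH : ∀ i, H.Adj i (finNext i)) (hnc : NonCrossing H Finset.univ)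
    (hE : 2 * n - 3 ≤ (edgesIn H Finset.univ).card) :
    ∃ S : Finset (Fin n),
      (d + 3) * S.card +
        (Finset.univ.filter fun i => (Finset.univ.filter (H.Adj i)).card = 2).card ≤ n ∧
      ∀ i, ¬ Dominated H S i →
        (Finset.univ.filter fun u => H.Adj i u ∧ ¬ Dominated H S u).card ≤ d + 1 := by
  set B : Finset (Fin n) :=
    Finset.univ.filter fun i => (Finset.univ.filter (H.Adj i)).card = 2 with hBdef
  set A : Finset (Fin n) := Finset.univ \ B with hAdef
  have hmemB : ∀ i, i ∈ B ↔ (Finset.univ.filter (H.Adj i)).card = 2 := by simp [hBdef]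
  have hmemA : ∀ i, i ∈ A ↔ i ∉ B := by simp [hAdef]
  have hindep : ∀ i ∈ B, ∀ j ∈ B, ¬ H.Adj i j := fun i hi j hj =>
    hnc.not_adj_of_degree_two (by rw [Finset.card_fin]; omega) (by rwa [Finset.card_fin])
      (Finset.mem_univ _) (Finset.mem_univ _) ((hmemB i).1 hi) ((hmemB j).1 hj)
  have hAB : A.card + B.card = n := by
    have := Finset.card_sdiff_add_card_eq_card (Finset.subset_univ B)
    rwa [Finset.card_fin] at this
  have hBA : B.card ≤ A.card :=
    Finset.card_le_card_of_injOn finNext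
      (fun i hi => (hmemA _).2 fun h => hindep i hi _ h (hH i)) finNext_injective.injOn
  have hle : (edgesIn H Finset.univ).card ≤ (edgesIn H A).card + 2 * B.card :=
    card_edgesIn_le_sdiff H Finset.univ B 2 fun v hv => ((hmemB v).1 hv).le
  have hncA : NonCrossing H A := hnc.mono (Finset.subset_univ _)
  obtain ⟨h1, h2⟩ := hncA.card_edgesIn (by omega)
  have hT : IsTri H A := h2 (by omega)
  obtain ⟨S, hSA, hS, hiso⟩ := hT.exists_isolates (d := d) rfl (by omega)
  refine ⟨S, by omega, fun i hi => ?_⟩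
  by_cases hiB : i ∈ B
  · rcases Nat.eq_zero_or_pos d with rfl | hd
    · refine (Finset.card_eq_zero.2 ?_).le.trans (Nat.zero_le _)
      rw [Finset.eq_empty_iff_forall_notMem]
      intro u hu
      simp only [Finset.mem_filter, Finset.mem_univ, true_and] at hu
      have huA : u ∈ A := (hmemA u).2 fun h => hindep i hiB u h hu.1
      have h3 := hiso u huA hu.2
      have h4 : 0 < (residual H A S u).card :=
        Finset.card_pos.2 ⟨u, mem_residual.2 ⟨huA, hu.2, Or.inl rfl⟩⟩
      omega
    · have h3 : (Finset.univ.filter fun u => H.Adj i u ∧ ¬ Dominated H S u).card ≤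
          (Finset.univ.filter (H.Adj i)).card :=
        Finset.card_le_card fun u hu => by
          simp only [Finset.mem_filter, Finset.mem_univ, true_and] at hu ⊢
          exact hu.1
      have h4 := (hmemB i).1 hiB
      omega
  · have hiA : i ∈ A := (hmemA i).2 hiB
    have hires : i ∈ residual H A S i := mem_residual.2 ⟨hiA, hi, Or.inl rfl⟩
    obtain ⟨p, hp⟩ := Finite.surjective_of_injective finNext_injective i
    have hsub : (Finset.univ.filter fun u => H.Adj i u ∧ ¬ Dominated H S u) ⊆
        (residual H A S i).erase i ∪ {finNext i, p} := by
      intro u hu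
      simp only [Finset.mem_filter, Finset.mem_univ, true_and] at hu
      simp only [Finset.mem_union, Finset.mem_erase, mem_residual, Finset.mem_insert,
        Finset.mem_singleton]
      by_cases huB : u ∈ B
      · rcases eq_finNext_of_degree_two (by omega) hH ((hmemB u).1 huB) hu.1.symm with h | h
        · exact Or.inr (Or.inr (finNext_injective (h.symm.trans hp.symm)))
        · exact Or.inr (Or.inl h.symm)
      · exact Or.inl ⟨hu.1.ne', (hmemA u).2 huB, hu.2, Or.inr hu.1⟩
    have h3 := (Finset.card_le_card hsub).trans (Finset.card_union_le _ _)
    have h4 := Finset.card_erase_of_mem hires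
    have h5 := Finset.card_pos.2 ⟨i, hires⟩
    have h6 := hiso i hiA hi
    have h7 : ({finNext i, p} : Finset (Fin n)).card ≤ 2 := Finset.card_le_two
    omega

lemma mem_closedNbhd_image {V : Type*} {n : ℕ} (G : SimpleGraph V) (σ : Fin n ≃ V)
    (S : Finset (Fin n)) (i : Fin n) :
    σ i ∈ closedNbhd G (σ '' S) ↔ Dominated (G.comap σ) S i := by
  simp only [closedNbhd, Dominated, Set.mem_union, σ.injective.mem_set_image, Finset.mem_coe,
    Set.mem_ofPred_eq, Set.exists_mem_image, SimpleGraph.comap_adj]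

lemma card_edgeSet_le_card_edgesIn {V : Type*} {n : ℕ} (G : SimpleGraph V) (σ : Fin n ≃ V) :
    Nat.card G.edgeSet ≤ (edgesIn (G.comap σ) Finset.univ).card := by
  classical
  have hsub : G.edgeSet ⊆
      ↑((edgesIn (G.comap σ) Finset.univ).image fun p => s(σ p.1, σ p.2)) := by
    intro e he
    induction e using Sym2.ind with
    | _ a b =>
    obtain ⟨i, rfl⟩ := σ.surjective a
    obtain ⟨j, rfl⟩ := σ.surjective b
    rw [SimpleGraph.mem_edgeSet] at he
    have hij : i ≠ j := by rintro rfl; exact he.ne rfl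
    rw [Finset.mem_coe, Finset.mem_image]
    rcases lt_or_gt_of_ne hij with h | h
    · exact ⟨(i, j), mem_edgesIn.2 ⟨by simp, h, he⟩, rfl⟩
    · exact ⟨(j, i), mem_edgesIn.2 ⟨by simp, h, he.symm⟩, Sym2.eq_swap⟩
  have h := Set.ncard_le_ncard hsub (Finset.finite_toSet _)
  rw [Set.ncard_coe_finset] at h
  exact h.trans Finset.card_image_le

/-- for `k ≥ 1` and a mop `G` of order `n ≥ 2k+3` with `n₂`
vertices of degree 2, `ι_k(G) ≤ (n - n₂) / (k+2)`. -/
theorem iotaK_mop_le_sub {V : Type*} [Finite V] (k : ℕ) (hk : 1 ≤ k)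
    (G : SimpleGraph V) (hG : IsMop G) (h : 2 * k + 3 ≤ Nat.card V) :
    (iotaK G k : ℝ) ≤ ((Nat.card V : ℝ) - ((deg2set G).ncard : ℝ)) / (k + 2) := by
  classical
  obtain ⟨n, hn, σ, hcyc, hcross, hedge⟩ := hG
  obtain ⟨d, rfl⟩ : ∃ d, k = d + 1 := ⟨k - 1, by omega⟩
  have hcard : Nat.card V = n := by rw [← Nat.card_congr σ, Nat.card_fin]
  rw [hcard] at h ⊢
  obtain ⟨S, hS, hiso⟩ := exists_isolates_of_cycle (n := n) (d := d) (by omega) (H := G.comap σ)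
    hcyc (fun a _ c _ b _ e _ h1 h2 h3 h4 h5 => hcross a b c e h4 h5 ⟨h1, h2, h3⟩)
    (hedge.symm.le.trans (card_edgeSet_le_card_edgesIn G σ))
  have hdeg : (deg2set G).ncard = (Finset.univ.filter fun i =>
      (Finset.univ.filter ((G.comap σ).Adj i)).card = 2).card := by
    rw [← Set.ncard_coe_finset, ← Set.ncard_image_of_injective _ σ.injective]
    congr 1
    ext v
    obtain ⟨i, rfl⟩ := σ.surjective v
    have : G.neighborSet (σ i) =
        σ '' (Finset.univ.filter ((G.comap σ).Adj i) : Finset (Fin n)) := by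
      ext w
      obtain ⟨j, rfl⟩ := σ.surjective w
      simp
    rw [σ.injective.mem_set_image, deg2set, Set.mem_ofPred_eq, this,
      Set.ncard_image_of_injective _ σ.injective, Set.ncard_coe_finset]
    simp
  have hiota : iotaK G (d + 1) ≤ S.card := by
    refine Nat.sInf_le ⟨σ '' S, S.finite_toSet.image _, ?_, ?_⟩
    · intro v hv
      obtain ⟨i, rfl⟩ := σ.surjective v
      rw [Set.mem_compl_iff, mem_closedNbhd_image] at hv
      have : G.neighborSet (σ i) ∩ (closedNbhd G (σ '' S))ᶜ =
          σ '' (Finset.univ.filter fun u => (G.comap σ).Adj i u ∧ ¬ Dominated (G.comap σ) S u :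
            Finset (Fin n)) := by
        ext w
        obtain ⟨j, rfl⟩ := σ.surjective w
        rw [Set.mem_inter_iff, Set.mem_compl_iff, mem_closedNbhd_image]
        simp
      rw [this, Set.ncard_image_of_injective _ σ.injective, Set.ncard_coe_finset]
      exact hiso i hv
    · rw [Set.ncard_image_of_injective _ σ.injective, Set.ncard_coe_finset]
  have hS' : (d + 3) * S.card + (deg2set G).ncard ≤ n := by
    rw [hdeg]
    convert hS
  have hmain : (d + 3) * iotaK G (d + 1) + (deg2set G).ncard ≤ n :=
    le_trans (by gcongr) hS'
  have hreal : ((d : ℝ) + 3) * iotaK G (d + 1) + (deg2set G).ncard ≤ n := by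
    exact_mod_cast hmain
  rw [le_div_iff₀ (by positivity)]
  push_cast
  linarith

end MopPaper
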